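/- Let Ω, Ω* ⊆ ℝ^d be open domains with Ω path-connected, and let f : Ω → Ω* be a C² embedding (a C² diffeomorphism onto its image) with everywhere positive Jacobian determinant. Suppose f has a periodic point x₀ of minimal period k, i.e. f^j(x₀) ∈ Ω for 0 ≤ j < k, f^k(x₀) = x₀, and k is minimal. Then there exists C > 0 such that for every sufficiently small r₀ > 0 there exist a C² embedding g : Ω → Ω* and, for each j = 0,1,…,k−1, concentric open Euclidean disks D_{1,j} ⊂ D_{0,j} centred at f^j(x₀) of radius at most r₀, with the closures of D_{0,0},…,D_{0,k−1} pairwise disjoint and contained in Ω, such that: (a) for each j, the restriction of g to D_{1,j} is the translation by f^{j+1}(x₀) − f^j(x₀) (indices mod k), mapping D_{1,j} onto D_{1,j+1 mod k}; (b) g = f on Ω ∖ (D_{0,0} ∪ … ∪ D_{0,k−1}); and (c) d_Lip(f,g) < C and d_Lip(f⁻¹, g⁻¹) < C, where the inverses are taken on the common image f(Ω) = g(Ω), and C does not depend on r₀. -/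

import Mathlib

open Set

section LocalizedDiffeo

open Metric Function Filter Topology
open scoped NNReal

section Localized

variable {E : Type*} [NormedAddCommGroup E] [NormedSpace ℝ E]

/-- `Φ` is a `C²` bi-Lipschitz immersion of `E` onto itself with inverse `Φ'`, equal to the
identity outside the ball of radius `r` about `p`. -/
structure IsLocalizedDiffeo (p : E) (r : ℝ) (L : ℝ≥0) (Φ Φ' : E → E) : Prop where
  contDiff : ContDiff ℝ 2 Φ
  fderiv_injective : ∀ x, Injective (fderiv ℝ Φ x)
  lipschitz : LipschitzWith L Φ
  lipschitz_inv : LipschitzWith L Φ'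
  left_inv : LeftInverse Φ' Φ
  right_inv : RightInverse Φ' Φ
  eq_self : ∀ x ∉ ball p r, Φ x = x

namespace IsLocalizedDiffeo

variable {p : E} {r : ℝ} {L L₁ L₂ : ℝ≥0} {Φ Φ' Ψ Ψ' : E → E}

theorem inv_eq_self (h : IsLocalizedDiffeo p r L Φ Φ') {x : E} (hx : x ∉ ball p r) : Φ' x = x := by
  conv_lhs => rw [← h.eq_self x hx]
  exact h.left_inv x

theorem mem_ball (h : IsLocalizedDiffeo p r L Φ Φ') {x : E} (hx : x ∈ ball p r) :
    Φ x ∈ ball p r := by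
  by_contra hn
  have := h.inv_eq_self hn
  rw [h.left_inv x] at this
  exact hn (this ▸ hx)

theorem inv_mem_ball (h : IsLocalizedDiffeo p r L Φ Φ') {x : E} (hx : x ∈ ball p r) :
    Φ' x ∈ ball p r := by
  by_contra hn
  have := h.eq_self _ hn
  rw [h.right_inv x] at this
  exact hn (this ▸ hx)

theorem comp (h₁ : IsLocalizedDiffeo p r L₁ Φ Φ') (h₂ : IsLocalizedDiffeo p r L₂ Ψ Ψ') :
    IsLocalizedDiffeo p r (L₁ * L₂) (Φ ∘ Ψ) (Ψ' ∘ Φ') where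
  contDiff := h₁.contDiff.comp h₂.contDiff
  fderiv_injective x := by
    rw [fderiv_comp x (h₁.contDiff.differentiable (by norm_num) _)
      (h₂.contDiff.differentiable (by norm_num) _)]
    exact (h₁.fderiv_injective _).comp (h₂.fderiv_injective _)
  lipschitz := h₁.lipschitz.comp h₂.lipschitz
  lipschitz_inv := mul_comm L₂ L₁ ▸ h₂.lipschitz_inv.comp h₁.lipschitz_inv
  left_inv := h₁.left_inv.comp h₂.left_inv
  right_inv := h₁.right_inv.comp h₂.right_inv
  eq_self x hx := by simp [h₂.eq_self x hx, h₁.eq_self x hx]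

theorem rescale (h : IsLocalizedDiffeo 0 1 L Φ Φ') (p : E) (hr : 0 < r) :
    IsLocalizedDiffeo p r L (fun x ↦ p + r • Φ (r⁻¹ • (x - p)))
      (fun x ↦ p + r • Φ' (r⁻¹ • (x - p))) where
  contDiff := contDiff_const.add
    ((h.contDiff.comp ((contDiff_id.sub contDiff_const).const_smul _)).const_smul r)
  fderiv_injective x := by
    have h1 : HasFDerivAt (fun x : E ↦ r⁻¹ • (x - p)) (r⁻¹ • ContinuousLinearMap.id ℝ E) x :=
      ((hasFDerivAt_id x).sub_const p).const_smul _
    have h2 : HasFDerivAt (fun x ↦ p + r • Φ (r⁻¹ • (x - p)))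
        (r • (fderiv ℝ Φ (r⁻¹ • (x - p))).comp (r⁻¹ • ContinuousLinearMap.id ℝ E)) x :=
      (((h.contDiff.differentiable (by norm_num) _).hasFDerivAt.comp x h1).const_smul r).const_add p
    rw [h2.fderiv]
    intro v w hvw
    apply h.fderiv_injective (r⁻¹ • (x - p))
    simpa [hr.ne'] using hvw
  lipschitz := by
    refine LipschitzWith.of_dist_le_mul fun x y ↦ ?_
    have := h.lipschitz.dist_le_mul (r⁻¹ • (x - p)) (r⁻¹ • (y - p))
    rw [dist_smul₀, dist_sub_right, Real.norm_of_nonneg (by positivity)] at this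
    rw [dist_add_left, dist_smul₀, Real.norm_of_nonneg hr.le]
    calc _ ≤ r * (L * (r⁻¹ * dist x y)) := by gcongr
      _ = _ := by field_simp
  lipschitz_inv := by
    refine LipschitzWith.of_dist_le_mul fun x y ↦ ?_
    have := h.lipschitz_inv.dist_le_mul (r⁻¹ • (x - p)) (r⁻¹ • (y - p))
    rw [dist_smul₀, dist_sub_right, Real.norm_of_nonneg (by positivity)] at this
    rw [dist_add_left, dist_smul₀, Real.norm_of_nonneg hr.le]
    calc _ ≤ r * (L * (r⁻¹ * dist x y)) := by gcongr
      _ = _ := by field_simp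
  left_inv x := by simp [hr.ne', h.left_inv _]
  right_inv x := by simp [hr.ne', h.right_inv _]
  eq_self x hx := by
    rw [h.eq_self]
    · simp [hr.ne']
    · simp only [mem_ball_iff_norm, not_lt, sub_zero, norm_smul] at hx ⊢
      rw [Real.norm_of_nonneg (by positivity), inv_mul_eq_div, one_le_div hr]
      exact hx

end IsLocalizedDiffeo

theorem exists_isLocalizedDiffeo_id_add [CompleteSpace E] {p : E} {r : ℝ} {η : E → E}
    (hη : ContDiff ℝ 2 η) (hlip : LipschitzWith (1 / 2) η) (hsupp : ∀ x ∉ ball p r, η x = 0) :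
    ∃ Φ', IsLocalizedDiffeo p r 2 (fun x ↦ x + η x) Φ' := by
  have hanti : ∀ x y, dist x y ≤ 2 * dist (x + η x) (y + η y) := fun x y ↦ by
    have h1 := hlip.dist_le_mul x y
    rw [dist_eq_norm] at h1 ⊢
    rw [dist_eq_norm]
    have h2 : ‖x - y‖ ≤ ‖x + η x - (y + η y)‖ + ‖η x - η y‖ := by
      rw [show x - y = (x + η x - (y + η y)) - (η x - η y) by abel]
      exact norm_sub_le _ _
    rw [dist_eq_norm] at h1
    push_cast at h1
    linarith
  have hsurj : Surjective (fun x ↦ x + η x) := fun y ↦ by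
    have hc : ContractingWith (1 / 2) (fun x ↦ y - η x) := by
      refine ⟨by rw [← NNReal.coe_lt_coe]; norm_num, ?_⟩
      exact LipschitzWith.of_dist_le_mul fun a b ↦ by
        rw [dist_sub_left]; exact hlip.dist_le_mul a b
    refine ⟨hc.fixedPoint _, ?_⟩
    have := hc.fixedPoint_isFixedPt
    simp only [IsFixedPt] at this
    dsimp only
    nth_rewrite 1 [← this]
    abel
  have hinj : Injective (fun x ↦ x + η x) := fun x y hxy ↦ by
    have := hanti x y
    simp only at hxy
    rw [hxy, dist_self, mul_zero] at this
    exact dist_le_zero.1 this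
  refine ⟨surjInv hsurj, contDiff_id.add hη, fun x ↦ ?_, ?_, ?_,
    leftInverse_surjInv ⟨hinj, hsurj⟩, rightInverse_surjInv hsurj, fun x hx ↦ by simp [hsupp x hx]⟩
  · have hd : DifferentiableAt ℝ η x := hη.differentiable (by norm_num) x
    have h1 : fderiv ℝ (fun x ↦ x + η x) x = ContinuousLinearMap.id ℝ E + fderiv ℝ η x :=
      ((hasFDerivAt_id x).add hd.hasFDerivAt).fderiv
    have h2 := norm_fderiv_le_of_lipschitz ℝ hlip (x₀ := x)
    rw [h1, injective_iff_map_eq_zero]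
    intro v hv
    have h3 : v = - fderiv ℝ η x v := eq_neg_of_add_eq_zero_left hv
    have h4 : ‖v‖ ≤ 1 / 2 * ‖v‖ := by
      conv_lhs => rw [h3, norm_neg]
      exact (ContinuousLinearMap.le_opNorm _ _).trans
        (mul_le_mul_of_nonneg_right (by simpa using h2) (norm_nonneg _))
    exact norm_le_zero_iff.1 (by linarith)
  · refine LipschitzWith.of_dist_le_mul fun x y ↦ (dist_add_add_le _ _ _ _).trans ?_
    have := hlip.dist_le_mul x y
    push_cast at this ⊢
    linarith [dist_nonneg (x := x) (y := y)]
  · refine LipschitzWith.of_dist_le_mul fun x y ↦ ?_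
    have := hanti (surjInv hsurj x) (surjInv hsurj y)
    rwa [surjInv_eq hsurj x, surjInv_eq hsurj y] at this

/-- `B` is the germ at the origin of a localized diffeomorphism of the unit ball. -/
def IsLocalizable (B : E →L[ℝ] E) : Prop :=
  ∃ (L : ℝ≥0) (H H' : E → E) (ε : ℝ), 0 < ε ∧ IsLocalizedDiffeo 0 1 L H H' ∧
    ∀ x ∈ ball (0 : E) ε, H x = B x

theorem IsLocalizable.mul {A B : E →L[ℝ] E} (hA : IsLocalizable A) (hB : IsLocalizable B) :
    IsLocalizable (A * B) := by
  obtain ⟨L₁, H₁, H₁', ε₁, hε₁, h₁, hA⟩ := hA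
  obtain ⟨L₂, H₂, H₂', ε₂, hε₂, h₂, hB⟩ := hB
  have hnear : ∀ᶠ x in 𝓝 (0 : E), B x ∈ ball (0 : E) ε₁ :=
    B.continuous.continuousAt.eventually_mem (by simpa using ball_mem_nhds (0 : E) hε₁)
  obtain ⟨ε, hε, hball⟩ := Metric.eventually_nhds_iff_ball.1
    (hnear.and (ball_mem_nhds (0 : E) hε₂))
  refine ⟨_, _, _, ε, hε, h₁.comp h₂, fun x hx ↦ ?_⟩
  simp [hB x (hball x hx).2, hA _ (hball x hx).1]

theorem exists_isLocalizable_of_norm_sub_one_le [HasContDiffBump E] [FiniteDimensional ℝ E] :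
    ∃ δ > 0, ∀ B : E →L[ℝ] E, ‖B - 1‖ ≤ δ → IsLocalizable B := by
  let χ : ContDiffBump (0 : E) := ⟨1 / 2, 1, by norm_num, by norm_num⟩
  have hχ : ContDiff ℝ 2 (fun x : E ↦ χ x • x) := χ.contDiff.smul contDiff_id
  obtain ⟨K, hK⟩ := hχ.lipschitzWith_of_hasCompactSupport χ.hasCompactSupport.smul_right
    (by norm_num)
  refine ⟨1 / (2 * (K + 1)), by positivity, fun B hB ↦ ?_⟩
  have hlip : LipschitzWith (1 / 2) (fun x ↦ (B - 1) (χ x • x)) := by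
    refine ((B - 1).lipschitz.comp hK).weaken ?_
    rw [← NNReal.coe_le_coe]
    push_cast
    calc ‖B - 1‖ * K ≤ 1 / (2 * (K + 1)) * (K + 1) := by gcongr; linarith
      _ = 1 / 2 := by field_simp
  have : CompleteSpace E := FiniteDimensional.complete ℝ E
  obtain ⟨Φ', h⟩ := exists_isLocalizedDiffeo_id_add (p := 0) (r := 1)
    ((B - 1).contDiff.comp hχ) hlip fun x hx ↦ by
      have : χ x = 0 := χ.zero_of_le_dist (by simpa using hx)
      simp [this]
  refine ⟨_, _, _, 1 / 2, by norm_num, h, fun x hx ↦ ?_⟩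
  have : χ x = 1 := χ.one_of_mem_closedBall (ball_subset_closedBall hx)
  simp [this]

theorem isLocalizable_one [HasContDiffBump E] [FiniteDimensional ℝ E] :
    IsLocalizable (1 : E →L[ℝ] E) := by
  obtain ⟨δ, hδ, h⟩ := exists_isLocalizable_of_norm_sub_one_le (E := E)
  exact h 1 (by simpa using hδ.le)

theorem IsLocalizable.pow [HasContDiffBump E] [FiniteDimensional ℝ E] {B : E →L[ℝ] E}
    (hB : IsLocalizable B) (n : ℕ) : IsLocalizable (B ^ n) := by
  induction n with
  | zero => simpa using isLocalizable_one
  | succ n ih => rw [pow_succ]; exact ih.mul hB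

end Localized

section LinearMaps

open Matrix

variable {ι : Type*} [Fintype ι] [DecidableEq ι]

theorem diagonal_eq_prod_transvection {i j : ι} (hij : i ≠ j) {c : ℝ} (hc : c ≠ 0) :
    diagonal (fun k ↦ if k = i then c else if k = j then c⁻¹ else 1) =
      transvection i j c * transvection j i (-c⁻¹) * transvection i j c *
        transvection i j (-1) * transvection j i 1 * transvection i j (-1) := by
  have hd : diagonal (fun k ↦ if k = i then c else if k = j then c⁻¹ else 1) =
      (1 : Matrix ι ι ℝ) + single i i (c - 1) + single j j (c⁻¹ - 1) := by
    ext a b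
    simp only [diagonal_apply, Matrix.add_apply, one_apply, single_apply]
    grind
  rw [hd]
  simp only [transvection, mul_add, add_mul, one_mul, mul_one, add_zero, single_mul_single_same,
    single_mul_single_of_ne _ _ _ _ hij, single_mul_single_of_ne _ _ _ _ hij.symm]
  ext a b
  simp only [Matrix.add_apply, one_apply, single_apply]
  grind

variable (P : Matrix ι ι ℝ → Prop)

theorem induction_of_det_pos {M : Matrix ι ι ℝ} (hM : 0 < M.det) (hone : P 1)
    (htransvec : ∀ i j : ι, i ≠ j → ∀ c : ℝ, P (transvection i j c))
    (hsmul : ∀ t : ℝ, 0 < t → P (t • 1)) (hmul : ∀ A B, P A → P B → P (A * B)) : P M := by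
  obtain hι | hι := isEmpty_or_nonempty ι
  · rwa [Subsingleton.elim M 1]
  have hcard : (Fintype.card ι : ℝ) ≠ 0 := by simp
  set t : ℝ := M.det ^ (1 / (Fintype.card ι : ℝ)) with ht
  have htpos : 0 < t := Real.rpow_pos_of_pos hM _
  have htpow : t ^ Fintype.card ι = M.det := by
    rw [ht, ← Real.rpow_natCast, ← Real.rpow_mul hM.le, one_div_mul_cancel hcard, Real.rpow_one]
  let S : SpecialLinearGroup ι ℝ := ⟨t⁻¹ • M, by
    rw [det_smul, inv_pow, htpow, inv_mul_cancel₀ hM.ne']⟩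
  suffices hS : P S.1 by
    have hMS : M = (t • 1) * S.1 := by simp [S, htpos.ne']
    rw [hMS]
    exact hmul _ _ (hsmul t htpos) hS
  obtain hι' | hι' := subsingleton_or_nontrivial ι
  · have : S = 1 := Subsingleton.elim _ _
    rw [this]
    exact hone
  · refine SpecialLinearGroup.diagonal_transvection_induction' (fun S ↦ P S.1) S
      (fun i j hij c hc ↦ ?_) (fun i j hij c ↦ htransvec i j hij c) fun A B ↦ hmul _ _
    rw [SpecialLinearGroup.diag2n_coe, diagonal_eq_prod_transvection hij hc]
    exact hmul _ _ (hmul _ _ (hmul _ _ (hmul _ _ (hmul _ _ (htransvec _ _ hij _)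
      (htransvec _ _ hij.symm _)) (htransvec _ _ hij _)) (htransvec _ _ hij _))
      (htransvec _ _ hij.symm _)) (htransvec _ _ hij _)

theorem transvection_pow {i j : ι} (hij : i ≠ j) (c : ℝ) (n : ℕ) :
    transvection i j c ^ n = transvection i j (n * c) := by
  induction n with
  | zero => simp
  | succ n ih =>
    rw [pow_succ, ih, transvection_mul_transvection_same _ _ hij]
    congr 1
    push_cast
    ring

theorem isLocalizable_toEuclideanCLM {M : Matrix ι ι ℝ} (hM : 0 < M.det) :
    IsLocalizable (toEuclideanCLM (n := ι) (𝕜 := ℝ) M) := by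
  obtain ⟨δ, hδ, hnear⟩ := exists_isLocalizable_of_norm_sub_one_le (E := EuclideanSpace ℝ ι)
  refine induction_of_det_pos (fun M ↦ IsLocalizable (toEuclideanCLM (n := ι) (𝕜 := ℝ) M)) hM
    (by simpa using isLocalizable_one) (fun i j hij c ↦ ?_) (fun t ht ↦ ?_) fun A B hA hB ↦ ?_
  · set T := toEuclideanCLM (n := ι) (𝕜 := ℝ) (single i j c) with hT
    obtain ⟨n, hn⟩ := exists_nat_ge (‖T‖ / δ)
    have hpow : transvection i j c = transvection i j (((n + 1 : ℕ) : ℝ)⁻¹ * c) ^ (n + 1) := by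
      rw [transvection_pow hij, mul_inv_cancel_left₀ (by positivity)]
    rw [hpow, map_pow]
    refine (hnear _ ?_).pow _
    have hsub : toEuclideanCLM (n := ι) (𝕜 := ℝ) (transvection i j (((n + 1 : ℕ) : ℝ)⁻¹ * c)) - 1
        = ((n + 1 : ℕ) : ℝ)⁻¹ • T := by
      rw [transvection, map_add, map_one, add_sub_cancel_left, hT, ← map_smul, smul_single,
        smul_eq_mul]
    rw [hsub, norm_smul, norm_inv, Real.norm_natCast, inv_mul_eq_div, div_le_iff₀ (by positivity)]
    rw [div_le_iff₀ hδ] at hn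
    push_cast
    linarith
  · have htend : Tendsto (fun n : ℕ ↦ t ^ (1 / ((n : ℝ) + 1))) atTop (𝓝 1) := by
      have := (Real.continuousAt_const_rpow (b := 0) ht.ne').tendsto.comp
        (tendsto_one_div_add_atTop_nhds_zero_nat (𝕜 := ℝ))
      simpa [comp_def] using this
    have hsmall : Tendsto (fun n : ℕ ↦
        ‖(t ^ (1 / ((n : ℝ) + 1))) • (1 : EuclideanSpace ℝ ι →L[ℝ] EuclideanSpace ℝ ι) - 1‖)
        atTop (𝓝 0) := by
      simpa using ((htend.smul_const
        (1 : EuclideanSpace ℝ ι →L[ℝ] EuclideanSpace ℝ ι)).sub_const 1).norm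
    obtain ⟨n, hn⟩ := (hsmall.eventually (gt_mem_nhds hδ)).exists
    have hpow : (t • 1 : Matrix ι ι ℝ) =
        ((t ^ (1 / ((n : ℝ) + 1))) • 1) ^ (n + 1) := by
      rw [smul_pow, one_pow, ← Real.rpow_natCast, ← Real.rpow_mul ht.le]
      push_cast
      rw [one_div_mul_cancel (by positivity), Real.rpow_one]
    rw [hpow, map_pow, map_smul, map_one]
    exact (hnear _ hn.le).pow _
  · rw [map_mul]
    exact hA.mul hB

theorem isLocalizable_of_det_pos {d : ℕ}
    {B : EuclideanSpace ℝ (Fin d) →L[ℝ] EuclideanSpace ℝ (Fin d)} (hB : 0 < B.det) :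
    IsLocalizable B := by
  obtain ⟨M, hMB⟩ : ∃ M, toEuclideanCLM (n := Fin d) (𝕜 := ℝ) M = B :=
    ⟨_, toEuclideanCLM.apply_symm_apply B⟩
  rw [← hMB] at hB ⊢
  apply isLocalizable_toEuclideanCLM
  rw [ContinuousLinearMap.det, coe_toEuclideanCLM_eq_toEuclideanLin] at hB
  change 0 < LinearMap.det (toLpLin 2 2 M) at hB
  rwa [toLpLin_eq_toLin, LinearMap.det_toLin] at hB

end LinearMaps

section Cutoff

variable {E : Type*} [NormedAddCommGroup E] [NormedSpace ℝ E]

theorem exists_isLocalizedDiffeo_eq_on_ball [HasContDiffBump E] [FiniteDimensional ℝ E]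
    {θ : E → E} {p : E} (hθ : ContDiffAt ℝ 2 θ p) (hp : θ p = p)
    (hd : HasStrictFDerivAt θ (ContinuousLinearMap.id ℝ E) p) :
    ∃ R > 0, ∀ r, 0 < r → r ≤ R → ∃ Ψ Ψ', IsLocalizedDiffeo p r 2 Ψ Ψ' ∧
      ∀ x ∈ ball p (r / 2), Ψ x = θ x := by
  let χ : ContDiffBump (0 : E) := ⟨1 / 2, 1, by norm_num, by norm_num⟩
  obtain ⟨K, hK⟩ := (χ.contDiff (n := 2)).lipschitzWith_of_hasCompactSupport χ.hasCompactSupport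
    (by norm_num)
  let ε : ℝ≥0 := 1 / (2 * (K + 1))
  have hε : (ε : ℝ) * (K + 1) = 1 / 2 := by
    simp only [ε]
    push_cast
    field_simp
  obtain ⟨s, hs, happrox⟩ := hd.approximates_deriv_on_nhds (c := ε) (Or.inr (by positivity))
  obtain ⟨R, hR, hball⟩ := Metric.eventually_nhds_iff_ball.1
    ((hθ.eventually (by simp)).and hs)
  refine ⟨R / 2, by positivity, fun r hr hrR ↦ ?_⟩
  have hlip : ∀ x ∈ ball p R, ∀ y ∈ ball p R, ‖(θ x - x) - (θ y - y)‖ ≤ ε * ‖x - y‖ :=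
    fun x hx y hy ↦ by
      have := happrox x (hball x hx).2 y (hball y hy).2
      rwa [ContinuousLinearMap.id_apply, show θ x - θ y - (x - y) = (θ x - x) - (θ y - y) by abel]
        at this
  let η : E → E := fun x ↦ χ (r⁻¹ • (x - p)) • (θ x - x)
  have hχ0 : ∀ x ∉ ball p r, χ (r⁻¹ • (x - p)) = 0 := fun x hx ↦ by
    refine χ.zero_of_le_dist ?_
    simp only [mem_ball_iff_norm, not_lt] at hx
    rw [dist_zero_right, norm_smul, Real.norm_of_nonneg (by positivity), inv_mul_eq_div,
      one_le_div hr]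
    exact hx
  have hsupp : ∀ x ∉ ball p r, η x = 0 := fun x hx ↦ by simp [η, hχ0 x hx]
  have hχK : ∀ x y, ‖χ (r⁻¹ • (x - p)) - χ (r⁻¹ • (y - p))‖ ≤ K * (r⁻¹ * ‖x - y‖) := fun x y ↦ by
    have := hK.dist_le_mul (r⁻¹ • (x - p)) (r⁻¹ • (y - p))
    rwa [dist_smul₀, dist_sub_right, Real.norm_of_nonneg (by positivity), dist_eq_norm,
      dist_eq_norm] at this
  have hin : ∀ x ∈ ball p r, ∀ y, ‖η x - η y‖ ≤ 1 / 2 * ‖x - y‖ := fun x hx y ↦ by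
    have hsub : ball p r ⊆ ball p R := ball_subset_ball (by linarith)
    have h1 : ‖θ x - x‖ ≤ ε * r := by
      have := hlip x (hsub hx) p (mem_ball_self hR)
      rw [hp, sub_self, sub_zero] at this
      exact this.trans (by gcongr; exact (mem_ball_iff_norm.1 hx).le)
    have h2 : ‖χ (r⁻¹ • (y - p)) • ((θ x - x) - (θ y - y))‖ ≤ ε * ‖x - y‖ := by
      by_cases hy : y ∈ ball p r
      · rw [norm_smul, Real.norm_of_nonneg χ.nonneg]
        exact (mul_le_of_le_one_left (norm_nonneg _) χ.le_one).trans
          (hlip x (hsub hx) y (hsub hy))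
      · rw [hχ0 y hy, zero_smul, norm_zero]
        positivity
    calc ‖η x - η y‖ = ‖(χ (r⁻¹ • (x - p)) - χ (r⁻¹ • (y - p))) • (θ x - x) +
          χ (r⁻¹ • (y - p)) • ((θ x - x) - (θ y - y))‖ := by
          simp only [η, sub_smul, smul_sub]; congr 1; abel
      _ ≤ K * (r⁻¹ * ‖x - y‖) * (ε * r) + ε * ‖x - y‖ := by
          refine (norm_add_le _ _).trans (add_le_add ?_ h2)
          rw [norm_smul]
          gcongr
          exact hχK x y
      _ = ε * (K + 1) * ‖x - y‖ := by field_simp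
      _ = _ := by rw [hε]
  have hηlip : LipschitzWith (1 / 2) η := by
    refine LipschitzWith.of_dist_le_mul fun x y ↦ ?_
    rw [dist_eq_norm, dist_eq_norm]
    push_cast
    by_cases hx : x ∈ ball p r
    · exact hin x hx y
    by_cases hy : y ∈ ball p r
    · rw [norm_sub_rev, norm_sub_rev x]
      exact hin y hy x
    · rw [hsupp x hx, hsupp y hy, sub_zero, norm_zero]
      positivity
  have hηC : ContDiff ℝ 2 η := contDiff_iff_contDiffAt.2 fun x ↦ by
    by_cases hx : x ∈ ball p R
    · exact (χ.contDiff.comp ((contDiff_id.sub contDiff_const).const_smul _)).contDiffAt.smul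
        ((hball x hx).1.sub contDiffAt_id)
    · refine (contDiffAt_const (c := (0 : E))).congr_of_eventuallyEq ?_
      have : x ∈ (closedBall p r)ᶜ := fun h ↦ hx (closedBall_subset_ball (by linarith) h)
      filter_upwards [isClosed_closedBall.isOpen_compl.mem_nhds this] with y hy
      exact hsupp y fun h ↦ hy (ball_subset_closedBall h)
  have : CompleteSpace E := FiniteDimensional.complete ℝ E
  obtain ⟨Ψ', h⟩ := exists_isLocalizedDiffeo_id_add hηC hηlip hsupp
  refine ⟨_, _, h, fun x hx ↦ ?_⟩
  have : χ (r⁻¹ • (x - p)) = 1 := by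
    refine χ.one_of_mem_closedBall ?_
    rw [mem_closedBall_zero_iff, norm_smul, Real.norm_of_nonneg (by positivity), inv_mul_le_iff₀ hr]
    have := mem_ball_iff_norm.1 hx
    simp only [χ]
    linarith
  simp [η, this]

end Cutoff

section LocalTranslation

theorem norm_sub_le_of_eq_zero_off_ball {E : Type*} [NormedAddCommGroup E] {Ω : Set E}
    {e w : E → E} {p : E} {r R C₁ C₂ δ : ℝ}
    (hδ : 0 < δ) (hC₁ : 0 ≤ C₁) (hC₂ : 0 ≤ C₂) (hw : ∀ x ∉ ball p r, w x = 0) (hr : r ≤ R)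
    (hlip : ∀ x ∈ ball p R, ∀ y ∈ ball p R, ‖w x - w y‖ ≤ C₁ * ‖e x - e y‖)
    (hbound : ∀ x ∈ ball p r, ‖w x‖ ≤ C₂)
    (hsep : ∀ x ∈ ball p r, ∀ y ∈ Ω \ ball p R, δ ≤ ‖e x - e y‖) :
    ∀ x ∈ Ω, ∀ y ∈ Ω, ‖w x - w y‖ ≤ (C₁ + C₂ / δ) * ‖e x - e y‖ := by
  have hin : ∀ x ∈ ball p r, ∀ y ∈ Ω, ‖w x - w y‖ ≤ (C₁ + C₂ / δ) * ‖e x - e y‖ := by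
    intro x hx y hy
    by_cases hyR : y ∈ ball p R
    · refine (hlip x (ball_subset_ball hr hx) y hyR).trans ?_
      gcongr
      exact le_add_of_nonneg_right (by positivity)
    · rw [hw y fun h ↦ hyR (ball_subset_ball hr h), sub_zero]
      calc ‖w x‖ ≤ C₂ / δ * δ := by rw [div_mul_cancel₀ _ hδ.ne']; exact hbound x hx
        _ ≤ (C₁ + C₂ / δ) * ‖e x - e y‖ := by
          gcongr
          · exact le_add_of_nonneg_left hC₁
          · exact hsep x hx y ⟨hy, hyR⟩
  intro x hx y hy
  by_cases hxr : x ∈ ball p r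
  · exact hin x hxr y hy
  by_cases hyr : y ∈ ball p r
  · rw [norm_sub_rev, norm_sub_rev (e x)]
    exact hin y hyr x hx
  · rw [hw x hxr, hw y hyr, sub_zero, norm_zero]
    positivity
variable {E : Type*} [NormedAddCommGroup E] [NormedSpace ℝ E]

theorem exists_isLocalizedDiffeo_translation [HasContDiffBump E] [FiniteDimensional ℝ E]
    {f : E → E} {p : E} {A : E ≃L[ℝ] E} (hf : ContDiffAt ℝ 2 f p)
    (hA : HasFDerivAt f (A : E →L[ℝ] E) p) (hloc : IsLocalizable (A.symm : E →L[ℝ] E)) :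
    ∃ L : ℝ≥0, ∃ R > 0, ∀ r, 0 < r → r ≤ R → ∃ ρ Φ Φ', 0 < ρ ∧ ρ < r ∧
      IsLocalizedDiffeo p r L Φ Φ' ∧ ∀ x ∈ ball p ρ, f (Φ x) = x + (f p - p) := by
  have : CompleteSpace E := FiniteDimensional.complete ℝ E
  obtain ⟨L, H, H', ε, hε, hH, hHA⟩ := hloc
  have hs : HasStrictFDerivAt f (A : E →L[ℝ] E) p := hf.hasStrictFDerivAt' hA (by norm_num)
  let a : E → E := fun x ↦ f p + A (x - p)
  have ha : HasStrictFDerivAt a (A : E →L[ℝ] E) p :=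
    ((A : E →L[ℝ] E).hasStrictFDerivAt.comp p ((hasStrictFDerivAt_id p).sub_const p)).const_add _
  have hap : a p = f p := by simp [a]
  have hθ : ContDiffAt ℝ 2 (hs.localInverse f A p ∘ a) p := by
    refine ContDiffAt.comp p ?_ (contDiffAt_const.add
      (A.contDiff.comp (contDiff_id.sub contDiff_const)).contDiffAt)
    rw [hap]
    exact hf.to_localInverse hA (by norm_num)
  have hd : HasStrictFDerivAt (hs.localInverse f A p ∘ a) (ContinuousLinearMap.id ℝ E) p := by
    have h1 := hs.to_localInverse
    rw [← hap] at h1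
    simpa [comp_def] using h1.comp p ha
  obtain ⟨R, hR, hΨ⟩ := exists_isLocalizedDiffeo_eq_on_ball hθ (by simp [hap]) hd
  refine ⟨2 * L, R, hR, fun r hr hrR ↦ ?_⟩
  obtain ⟨Ψ, Ψ', hΨ, hΨθ⟩ := hΨ r hr hrR
  have hHr := hH.rescale p hr
  set Hr := fun x ↦ p + r • H (r⁻¹ • (x - p)) with hHr_def
  have hHrA : ∀ᶠ x in 𝓝 p, Hr x = p + A.symm (x - p) := by
    filter_upwards [ball_mem_nhds p (mul_pos hr hε)] with x hx
    have : r⁻¹ • (x - p) ∈ ball (0 : E) ε := by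
      rw [mem_ball_zero_iff, norm_smul, Real.norm_of_nonneg (by positivity), inv_mul_lt_iff₀ hr]
      exact mem_ball_iff_norm.1 hx
    rw [hHr_def]
    dsimp only
    rw [hHA _ this, map_smul, smul_inv_smul₀ hr.ne']
    rfl
  have hHrp : Hr p = p := by simpa using hHrA.self_of_nhds
  have hnear : ∀ᶠ x in 𝓝 p, Hr x ∈ ball p (r / 2) :=
    hHr.contDiff.continuous.continuousAt.eventually_mem
      (by rw [hHrp]; exact ball_mem_nhds p (by positivity))
  have hright : ∀ᶠ x in 𝓝 p, f (hs.localInverse f A p (f p + (x - p))) = f p + (x - p) := by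
    have : Tendsto (fun x ↦ f p + (x - p)) (𝓝 p) (𝓝 (f p)) := by
      have : Continuous (fun x ↦ f p + (x - p)) := by fun_prop
      simpa using this.tendsto p
    exact this.eventually hs.eventually_right_inverse
  obtain ⟨ρ, hρ, hball⟩ := Metric.eventually_nhds_iff_ball.1 ((hHrA.and hnear).and hright)
  refine ⟨min ρ (r / 2), _, _, by positivity, (min_le_right _ _).trans_lt (by linarith),
    hΨ.comp hHr, fun x hx ↦ ?_⟩
  obtain ⟨⟨h1, h2⟩, h3⟩ := hball x (ball_subset_ball (min_le_left _ _) hx)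
  rw [comp_apply, hΨθ _ h2, h1, comp_apply]
  simp only [a, add_sub_cancel_left, ContinuousLinearEquiv.apply_symm_apply]
  rw [h3]
  abel

theorem exists_bilipschitz_ball_and_separation [CompleteSpace E] {Ω : Set E} (hΩ : IsOpen Ω)
    {f : E → E} {p : E} {A : E ≃L[ℝ] E} (hinj : InjOn f Ω) (hp : p ∈ Ω)
    (hf : HasStrictFDerivAt f (A : E →L[ℝ] E) p) :
    ∃ M N : ℝ≥0, ∃ R > 0, ball p R ⊆ Ω ∧
      (∀ x ∈ ball p R, ∀ y ∈ ball p R, ‖f x - f y‖ ≤ M * ‖x - y‖) ∧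
      (∀ x ∈ ball p R, ∀ y ∈ ball p R, ‖x - y‖ ≤ N * ‖f x - f y‖) ∧
      ∃ δ > 0, ∃ R' > 0, ∀ x ∈ ball p R', ∀ y ∈ Ω \ ball p R, δ ≤ ‖f x - f y‖ := by
  obtain ⟨M, s, hs, hM⟩ := hf.exists_lipschitzOnWith
  obtain ⟨N, t, ht, hN⟩ := hf.to_localInverse.exists_lipschitzOnWith
  obtain ⟨R, hR, hball⟩ := Metric.eventually_nhds_iff_ball.1
    (((hΩ.eventually_mem hp).and hs).and
      (hf.eventually_left_inverse.and (hf.continuousAt.eventually_mem ht)))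
  refine ⟨M, N, R, hR, fun x hx ↦ (hball x hx).1.1, fun x hx y hy ↦ ?_, fun x hx y hy ↦ ?_, ?_⟩
  · simpa only [dist_eq_norm] using hM.dist_le_mul x (hball x hx).1.2 y (hball y hy).1.2
  · have := hN.dist_le_mul _ (hball x hx).2.2 _ (hball y hy).2.2
    rwa [(hball x hx).2.1, (hball y hy).2.1, dist_eq_norm, dist_eq_norm] at this
  have himage : f '' ball p R ∈ 𝓝 (f p) := by
    rw [← hf.map_nhds_eq_of_equiv]
    exact image_mem_map (ball_mem_nhds p hR)
  obtain ⟨δ, hδ, hsub⟩ := Metric.mem_nhds_iff.1 himage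
  obtain ⟨R', hR', hsub'⟩ := Metric.eventually_nhds_iff_ball.1
    (hf.continuousAt.eventually_mem (ball_mem_nhds (f p) (half_pos hδ)))
  refine ⟨δ / 2, half_pos hδ, R', hR', fun x hx y hy ↦ ?_⟩
  have h1 : δ ≤ ‖f y - f p‖ := by
    by_contra! h
    obtain ⟨z, hz, hzy⟩ := hsub (mem_ball_iff_norm.2 h)
    exact hy.2 (hinj (hball z hz).1.1 hy.1 hzy ▸ hz)
  have h2 := mem_ball_iff_norm.1 (hsub' x hx)
  have h3 : ‖f y - f p‖ ≤ ‖f x - f y‖ + ‖f x - f p‖ := by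
    rw [show f y - f p = (f x - f p) - (f x - f y) by abel, add_comm]
    exact norm_sub_le _ _
  linarith

theorem exists_controlled_localizedDiffeo [HasContDiffBump E] [FiniteDimensional ℝ E]
    {Ω : Set E} (hΩ : IsOpen Ω) {f : E → E} {p : E} {A : E ≃L[ℝ] E} (hinj : InjOn f Ω)
    (hp : p ∈ Ω) (hf : ContDiffAt ℝ 2 f p) (hA : HasFDerivAt f (A : E →L[ℝ] E) p)
    (hloc : IsLocalizable (A.symm : E →L[ℝ] E)) :
    ∃ C ≥ 0, ∃ R > 0, ∀ r, 0 < r → r ≤ R → ∃ ρ L Φ Φ', 0 < ρ ∧ ρ < r ∧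
      IsLocalizedDiffeo p r L Φ Φ' ∧ (∀ x ∈ ball p ρ, f (Φ x) = x + (f p - p)) ∧
      (∀ x ∈ Ω, ‖f x - f (Φ x)‖ ≤ C) ∧
      (∀ x ∈ Ω, ∀ y ∈ Ω, ‖(f x - f (Φ x)) - (f y - f (Φ y))‖ ≤ C * ‖x - y‖) ∧
      (∀ x ∈ Ω, ‖Φ' x - x‖ ≤ C) ∧
      (∀ x ∈ Ω, ∀ y ∈ Ω, ‖(Φ' x - x) - (Φ' y - y)‖ ≤ C * ‖f x - f y‖) := by
  have : CompleteSpace E := FiniteDimensional.complete ℝ E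
  obtain ⟨L, R₁, hR₁, hΦ⟩ := exists_isLocalizedDiffeo_translation hf hA hloc
  obtain ⟨M, N, R, hR, -, hM, hN, δ, hδ, R', hR', hsep⟩ :=
    exists_bilipschitz_ball_and_separation hΩ hinj hp (hf.hasStrictFDerivAt' hA (by norm_num))
  let C₁ : ℝ := M * (2 * R)
  let C₂ : ℝ := M * (1 + L) + M * (2 * R) / (R / 2)
  let C₃ : ℝ := 2 * R
  let C₄ : ℝ := (1 + L) * N + 2 * R / δ
  have hC₁ : 0 ≤ C₁ := by positivity
  have hC₂ : 0 ≤ C₂ := by positivity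
  have hC₃ : 0 ≤ C₃ := by positivity
  have hC₄ : 0 ≤ C₄ := by positivity
  refine ⟨C₁ + C₂ + C₃ + C₄, by positivity, min R₁ (min R' (R / 2)), by positivity,
    fun r hr hrR ↦ ?_⟩
  simp only [le_min_iff] at hrR
  obtain ⟨hrR₁, hrR', hrR⟩ := hrR
  obtain ⟨ρ, Φ, Φ', hρ, hρr, h, htrans⟩ := hΦ r hr hrR₁
  have hrR2 : r ≤ R := by linarith
  have hmaps : ∀ x ∈ ball p R, Φ x ∈ ball p R := fun x hx ↦ by
    by_cases hxr : x ∈ ball p r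
    · exact ball_subset_ball hrR2 (h.mem_ball hxr)
    · rwa [h.eq_self x hxr]
  have hdist : ∀ x ∈ ball p r, ∀ y ∈ ball p r, ‖x - y‖ ≤ 2 * R := fun x hx y hy ↦ by
    rw [← dist_eq_norm]
    linarith [dist_triangle_right x y p, mem_ball.1 hx, mem_ball.1 hy]
  have hb₁ : ∀ x ∈ ball p r, ‖f x - f (Φ x)‖ ≤ M * (2 * R) := fun x hx ↦
    (hM x (ball_subset_ball hrR2 hx) _ (ball_subset_ball hrR2 (h.mem_ball hx))).trans
      (by gcongr; exact hdist x hx _ (h.mem_ball hx))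
  have hb₂ : ∀ x ∈ ball p r, ‖Φ' x - x‖ ≤ 2 * R := fun x hx ↦ hdist _ (h.inv_mem_ball hx) x hx
  have hz₁ : ∀ x ∉ ball p r, f x - f (Φ x) = 0 := fun x hx ↦ by rw [h.eq_self x hx, sub_self]
  have hz₂ : ∀ x ∉ ball p r, Φ' x - x = 0 := fun x hx ↦ by rw [h.inv_eq_self hx, sub_self]
  have hlip₁ := norm_sub_le_of_eq_zero_off_ball (Ω := Ω) (e := id) (C₁ := M * (1 + L))
    (half_pos hR) (by positivity) (by positivity) hz₁ hrR2 (fun x hx y hy ↦ by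
      have hL := h.lipschitz.dist_le_mul x y
      rw [dist_eq_norm, dist_eq_norm] at hL
      calc ‖f x - f (Φ x) - (f y - f (Φ y))‖ = ‖(f x - f y) - (f (Φ x) - f (Φ y))‖ := by
            congr 1; abel
        _ ≤ M * ‖x - y‖ + M * (L * ‖x - y‖) := by
            refine (norm_sub_le _ _).trans (add_le_add (hM x hx y hy) ?_)
            exact (hM _ (hmaps x hx) _ (hmaps y hy)).trans (by gcongr)
        _ = _ := by simp only [id]; ring) hb₁ (fun x hx y hy ↦ by
      have h1 := mem_ball.1 hx
      have h2 := not_lt.1 (mt mem_ball.2 hy.2)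
      rw [id, id, ← dist_eq_norm]
      linarith [dist_triangle_left y p x])
  have hlip₂ := norm_sub_le_of_eq_zero_off_ball (Ω := Ω) (e := f) (C₁ := (1 + L) * N)
    hδ (by positivity) (by positivity) hz₂ hrR2 (fun x hx y hy ↦ by
      have hL := h.lipschitz_inv.dist_le_mul x y
      rw [dist_eq_norm, dist_eq_norm] at hL
      calc ‖Φ' x - x - (Φ' y - y)‖ = ‖(Φ' x - Φ' y) - (x - y)‖ := by congr 1; abel
        _ ≤ L * ‖x - y‖ + ‖x - y‖ := (norm_sub_le _ _).trans (by gcongr)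
        _ = (1 + L) * ‖x - y‖ := by ring
        _ ≤ (1 + L) * (N * ‖f x - f y‖) := by gcongr; exact hN x hx y hy
        _ = _ := by ring) hb₂ (fun x hx y hy ↦ hsep x (ball_subset_ball hrR' hx) y hy)
  refine ⟨ρ, L, Φ, Φ', hρ, hρr, h, htrans, fun x _ ↦ ?_, fun x hx y hy ↦ ?_, fun x _ ↦ ?_,
    fun x hx y hy ↦ ?_⟩
  · by_cases hx : x ∈ ball p r
    · exact (hb₁ x hx).trans (by simp only [C₁] at *; linarith)
    · rw [hz₁ x hx, norm_zero]
      positivity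
  · exact (hlip₁ x hx y hy).trans
      (mul_le_mul_of_nonneg_right (show C₂ ≤ _ by linarith) (norm_nonneg _))
  · by_cases hx : x ∈ ball p r
    · exact (hb₂ x hx).trans (by simp only [C₃] at *; linarith)
    · rw [hz₂ x hx, norm_zero]
      positivity
  · exact (hlip₂ x hx y hy).trans
      (mul_le_mul_of_nonneg_right (show C₄ ≤ _ by linarith) (norm_nonneg _))

end LocalTranslation

section Glue

variable {ι E : Type*} [Fintype ι] [NormedAddCommGroup E]

/-- The superposition of the displacements of the maps `Φ i`. -/
def glue (Φ : ι → E → E) (x : E) : E := x + ∑ i, (Φ i x - x)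

theorem glue_eq_self {Φ : ι → E → E} {x : E} (h : ∀ i, Φ i x = x) : glue Φ x = x := by
  simp [glue, h]

theorem glue_eq_of_forall_ne {Φ : ι → E → E} {x : E} {i : ι} (h : ∀ j ≠ i, Φ j x = x) :
    glue Φ x = Φ i x := by
  rw [glue, Fintype.sum_eq_single i fun j hj ↦ by rw [h j hj, sub_self], add_sub_cancel]

theorem glue_eq_of_mem_ball {Φ : ι → E → E} {p : ι → E} {r : ℝ}
    (hdisj : ∀ i j, i ≠ j → Disjoint (closedBall (p i) r) (closedBall (p j) r))
    (hΦ : ∀ i, ∀ x ∉ ball (p i) r, Φ i x = x) {i : ι} {x : E} (hx : x ∈ ball (p i) r) :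
    glue Φ x = Φ i x :=
  glue_eq_of_forall_ne fun j hj ↦ hΦ j x fun h ↦ disjoint_left.1 (hdisj j i hj)
    (ball_subset_closedBall h) (ball_subset_closedBall hx)

theorem leftInverse_glue {Φ Ψ : ι → E → E} {p : ι → E} {r : ℝ}
    (hdisj : ∀ i j, i ≠ j → Disjoint (closedBall (p i) r) (closedBall (p j) r))
    (hΦ : ∀ i, ∀ x ∉ ball (p i) r, Φ i x = x) (hΨ : ∀ i, ∀ x ∉ ball (p i) r, Ψ i x = x)
    (hmaps : ∀ i, ∀ x ∈ ball (p i) r, Φ i x ∈ ball (p i) r)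
    (hinv : ∀ i, LeftInverse (Ψ i) (Φ i)) : LeftInverse (glue Ψ) (glue Φ) := by
  intro x
  by_cases hx : ∃ i, x ∈ ball (p i) r
  · obtain ⟨i, hi⟩ := hx
    rw [glue_eq_of_mem_ball hdisj hΦ hi, glue_eq_of_mem_ball hdisj hΨ (hmaps i x hi), hinv i x]
  · push Not at hx
    rw [glue_eq_self fun i ↦ hΦ i x (hx i), glue_eq_self fun i ↦ hΨ i x (hx i)]

theorem mapsTo_glue {Φ : ι → E → E} {p : ι → E} {r : ℝ} {Ω : Set E}
    (hdisj : ∀ i j, i ≠ j → Disjoint (closedBall (p i) r) (closedBall (p j) r))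
    (hΦ : ∀ i, ∀ x ∉ ball (p i) r, Φ i x = x)
    (hmaps : ∀ i, ∀ x ∈ ball (p i) r, Φ i x ∈ ball (p i) r)
    (hsub : ∀ i, closedBall (p i) r ⊆ Ω) : MapsTo (glue Φ) Ω Ω := by
  intro x hxΩ
  by_cases hx : ∃ i, x ∈ ball (p i) r
  · obtain ⟨i, hi⟩ := hx
    rw [glue_eq_of_mem_ball hdisj hΦ hi]
    exact hsub i (ball_subset_closedBall (hmaps i x hi))
  · push Not at hx
    rwa [glue_eq_self fun i ↦ hΦ i x (hx i)]

theorem sub_comp_glue_eq_sum {Φ : ι → E → E} {p : ι → E} {r : ℝ} (f : E → E)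
    (hdisj : ∀ i j, i ≠ j → Disjoint (closedBall (p i) r) (closedBall (p j) r))
    (hΦ : ∀ i, ∀ x ∉ ball (p i) r, Φ i x = x) (x : E) :
    f x - f (glue Φ x) = ∑ i, (f x - f (Φ i x)) := by
  by_cases hx : ∃ i, x ∈ ball (p i) r
  · obtain ⟨i, hi⟩ := hx
    rw [glue_eq_of_mem_ball hdisj hΦ hi, Fintype.sum_eq_single i]
    intro j hj
    rw [hΦ j x fun h ↦ disjoint_left.1 (hdisj j i hj) (ball_subset_closedBall h)
      (ball_subset_closedBall hi), sub_self]
  · push Not at hx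
    rw [glue_eq_self fun i ↦ hΦ i x (hx i), sub_self,
      Finset.sum_eq_zero fun i _ ↦ by rw [hΦ i x (hx i), sub_self]]

theorem contDiff_glue [NormedSpace ℝ E] {Φ : ι → E → E} (hΦ : ∀ i, ContDiff ℝ 2 (Φ i)) :
    ContDiff ℝ 2 (glue Φ) :=
  contDiff_id.add (ContDiff.sum fun i _ ↦ (hΦ i).sub contDiff_id)

theorem fderiv_glue_injective [NormedSpace ℝ E] {Φ : ι → E → E} {p : ι → E} {r : ℝ}
    (hdisj : ∀ i j, i ≠ j → Disjoint (closedBall (p i) r) (closedBall (p j) r))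
    (hΦ : ∀ i, ∀ x ∉ ball (p i) r, Φ i x = x)
    (hinj : ∀ i x, Injective (fderiv ℝ (Φ i) x)) (x : E) : Injective (fderiv ℝ (glue Φ) x) := by
  have hoff : ∀ i, x ∉ closedBall (p i) r → ∀ᶠ y in 𝓝 x, Φ i y = y := fun i hi ↦ by
    filter_upwards [isClosed_closedBall.isOpen_compl.mem_nhds hi] with y hy
    exact hΦ i y fun h ↦ hy (ball_subset_closedBall h)
  by_cases hx : ∃ i, x ∈ closedBall (p i) r
  · obtain ⟨i, hi⟩ := hx
    have : glue Φ =ᶠ[𝓝 x] Φ i := by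
      have : ∀ᶠ y in 𝓝 x, ∀ j, j ≠ i → Φ j y = y := eventually_all.2 fun j ↦ by
        by_cases hj : j = i
        · simp [hj]
        · filter_upwards [hoff j fun h ↦ disjoint_left.1 (hdisj j i hj) h hi] with y hy _
          exact hy
      exact this.mono fun y hy ↦ glue_eq_of_forall_ne hy
    rw [this.fderiv_eq]
    exact hinj i x
  · push Not at hx
    have : glue Φ =ᶠ[𝓝 x] id :=
      (eventually_all.2 fun i ↦ hoff i (hx i)).mono fun y hy ↦ glue_eq_self hy
    rw [this.fderiv_eq, fderiv_id]
    exact injective_id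

end Glue

section Orbit

theorem iterate_injective_of_minimal_period {α : Type*} {f : α → α} {k : ℕ} {x : α}
    (hper : f^[k] x = x) (hmin : ∀ j, 1 ≤ j → j < k → f^[j] x ≠ x) :
    Injective (fun j : Fin k ↦ f^[(j : ℕ)] x) := by
  have hlt : ∀ i j : Fin k, i < j → f^[(i : ℕ)] x ≠ f^[(j : ℕ)] x := fun i j hij h ↦ by
    refine hmin (k - j + i) (by omega) (by omega) ?_
    rw [iterate_add_apply, h, ← iterate_add_apply, Nat.sub_add_cancel j.2.le, hper]
  intro i j h
  by_contra hne
  rcases lt_or_gt_of_ne hne with hij | hij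
  · exact hlt i j hij h
  · exact hlt j i hij h.symm

theorem apply_iterate_eq_iterate_mod {α : Type*} {f : α → α} {k : ℕ} {x : α}
    (hper : f^[k] x = x) (j : ℕ) : f (f^[j] x) = f^[(j + 1) % k] x :=
  (iterate_succ_apply' f j x).symm.trans (IsPeriodicPt.iterate_mod_apply hper (j + 1)).symm

theorem exists_forall_closedBall_disjoint {ι E : Type*} [Finite ι] [NormedAddCommGroup E]
    {p : ι → E} (hp : Injective p) {Ω : Set E} (hΩ : IsOpen Ω) (hpΩ : ∀ i, p i ∈ Ω) {S : ι → ℝ}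
    (hS : ∀ i, 0 < S i) :
    ∃ R > 0, ∀ r, 0 < r → r ≤ R →
      (∀ i j, i ≠ j → Disjoint (closedBall (p i) r) (closedBall (p j) r)) ∧
      (∀ i, closedBall (p i) r ⊆ Ω) ∧ ∀ i, r ≤ S i := by
  have h1 : ∀ᶠ r in 𝓝 (0 : ℝ), ∀ i j, i ≠ j →
      Disjoint (closedBall (p i) r) (closedBall (p j) r) := by
    refine eventually_all.2 fun i ↦ eventually_all.2 fun j ↦ ?_
    by_cases hij : i = j
    · simp [hij]
    · have hpos : 0 < dist (p i) (p j) := dist_pos.2 (hp.ne hij)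
      filter_upwards [gt_mem_nhds (half_pos hpos)] with r hr _
      exact closedBall_disjoint_closedBall (by linarith)
  have h2 : ∀ᶠ r in 𝓝 (0 : ℝ), ∀ i, closedBall (p i) r ⊆ Ω := eventually_all.2 fun i ↦ by
    obtain ⟨ε, hε, hsub⟩ := nhds_basis_closedBall.mem_iff.1 (hΩ.mem_nhds (hpΩ i))
    filter_upwards [gt_mem_nhds hε] with r hr
    exact (closedBall_subset_closedBall hr.le).trans hsub
  have h3 : ∀ᶠ r in 𝓝 (0 : ℝ), ∀ i, r ≤ S i :=
    eventually_all.2 fun i ↦ (gt_mem_nhds (hS i)).mono fun _ h ↦ le_of_lt h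
  obtain ⟨R, hR, hball⟩ := Metric.eventually_nhds_iff_ball.1 (h1.and (h2.and h3))
  refine ⟨R / 2, half_pos hR, fun r hr hrR ↦ hball r ?_⟩
  rw [mem_ball_zero_iff, Real.norm_of_nonneg hr.le]
  linarith

end Orbit

theorem exists_controlled_localizedDiffeo_of_det_pos {d : ℕ}
    {Ω : Set (EuclideanSpace ℝ (Fin d))} (hΩ : IsOpen Ω)
    {f : EuclideanSpace ℝ (Fin d) → EuclideanSpace ℝ (Fin d)} {p : EuclideanSpace ℝ (Fin d)}
    (hinj : InjOn f Ω) (hp : p ∈ Ω) (hf : ContDiffOn ℝ 2 f Ω) (hdet : 0 < (fderiv ℝ f p).det) :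
    ∃ C ≥ 0, ∃ R > 0, ∀ r, 0 < r → r ≤ R → ∃ ρ L Φ Φ', 0 < ρ ∧ ρ < r ∧
      IsLocalizedDiffeo p r L Φ Φ' ∧ (∀ x ∈ ball p ρ, f (Φ x) = x + (f p - p)) ∧
      (∀ x ∈ Ω, ‖f x - f (Φ x)‖ ≤ C) ∧
      (∀ x ∈ Ω, ∀ y ∈ Ω, ‖(f x - f (Φ x)) - (f y - f (Φ y))‖ ≤ C * ‖x - y‖) ∧
      (∀ x ∈ Ω, ‖Φ' x - x‖ ≤ C) ∧
      (∀ x ∈ Ω, ∀ y ∈ Ω, ‖(Φ' x - x) - (Φ' y - y)‖ ≤ C * ‖f x - f y‖) := by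
  have hfp : ContDiffAt ℝ 2 f p := hf.contDiffAt (hΩ.mem_nhds hp)
  let A := (fderiv ℝ f p).toContinuousLinearEquivOfDetNeZero hdet.ne'
  have hA : (A : EuclideanSpace ℝ (Fin d) →L[ℝ] EuclideanSpace ℝ (Fin d)) = fderiv ℝ f p :=
    ContinuousLinearMap.coe_toContinuousLinearEquivOfDetNeZero _ _
  refine exists_controlled_localizedDiffeo hΩ hinj hp hfp (A := A) ?_ ?_
  · rw [hA]
    exact (hfp.differentiableAt (by norm_num)).hasFDerivAt
  · refine isLocalizable_of_det_pos ?_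
    have h := A.det_coe_symm
    rw [h, hA]
    exact inv_pos.2 hdet

end LocalizedDiffeo

/-- **Blow-up of a periodic orbit to a cycle of translated disks**: let `Ω, Ω* ⊆ ℝ^d` be
open with `Ω` path-connected, and let `f : Ω → Ω*` be an orientation-preserving `C²`
embedding with a periodic point `x₀` of minimal period `k`.  There is `C > 0` such that for
every sufficiently small `r₀ > 0` there exist a `C²` embedding `g : Ω → Ω*` and concentric
open disks `D_{1,j} ⊂ D_{0,j}` about the orbit points `f^j x₀` of radius at most `r₀`, with
pairwise disjoint closures contained in `Ω`, such that (a) on each `D_{1,j}` the map `g` is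
the translation taking `D_{1,j}` onto `D_{1,j+1 mod k}`; (b) `g = f` off `⋃ D_{0,j}`; and
(c) `d_Lip(f,g) < C` and `d_Lip(f⁻¹,g⁻¹) < C`, with `C` independent of `r₀`. -/
theorem blowup_periodic_orbit {d : ℕ}
    (Ω Ωs : Set (EuclideanSpace ℝ (Fin d))) (hΩ : IsOpen Ω) (hΩs : IsOpen Ωs)
    (hpc : IsPathConnected Ω)
    (f : EuclideanSpace ℝ (Fin d) → EuclideanSpace ℝ (Fin d))
    (hf : ContDiffOn ℝ 2 f Ω) (hinj : Set.InjOn f Ω) (hmaps : Set.MapsTo f Ω Ωs)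
    (hdet : ∀ x ∈ Ω, 0 < (fderiv ℝ f x).det)
    (k : ℕ) (hk : 1 ≤ k) (x₀ : EuclideanSpace ℝ (Fin d))
    (horb : ∀ j < k, f^[j] x₀ ∈ Ω) (hper : f^[k] x₀ = x₀)
    (hmin : ∀ j : ℕ, 1 ≤ j → j < k → f^[j] x₀ ≠ x₀) :
    ∃ C : ℝ, 0 < C ∧ ∃ R : ℝ, 0 < R ∧ ∀ r₀ : ℝ, 0 < r₀ → r₀ ≤ R →
      ∃ (g : EuclideanSpace ℝ (Fin d) → EuclideanSpace ℝ (Fin d)) (r ρ : Fin k → ℝ),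
        (∀ j : Fin k, 0 < ρ j ∧ ρ j < r j ∧ r j ≤ r₀) ∧
        (∀ i j : Fin k, i ≠ j →
          Disjoint (Metric.closedBall (f^[(i : ℕ)] x₀) (r i))
            (Metric.closedBall (f^[(j : ℕ)] x₀) (r j))) ∧
        (∀ j : Fin k, Metric.closedBall (f^[(j : ℕ)] x₀) (r j) ⊆ Ω) ∧
        -- `g` is a `C²` embedding of `Ω` into `Ω*`
        ContDiffOn ℝ 2 g Ω ∧ Set.InjOn g Ω ∧ Set.MapsTo g Ω Ωs ∧
        (∀ x ∈ Ω, Function.Injective (fderiv ℝ g x)) ∧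
        -- (a) on `D_{1,j}` the map `g` is the translation onto `D_{1,j+1 mod k}`
        (∀ j : Fin k,
          (∀ x ∈ Metric.ball (f^[(j : ℕ)] x₀) (ρ j),
            g x = x + (f^[((j : ℕ) + 1) % k] x₀ - f^[(j : ℕ)] x₀)) ∧
          (fun x => x + (f^[((j : ℕ) + 1) % k] x₀ - f^[(j : ℕ)] x₀)) ''
              Metric.ball (f^[(j : ℕ)] x₀) (ρ j) =
            Metric.ball (f^[((j : ℕ) + 1) % k] x₀) (ρ ⟨((j : ℕ) + 1) % k, Nat.mod_lt _ (by omega)⟩)) ∧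
        -- (b) `g = f` outside the disks `D_{0,j}`
        (∀ x ∈ Ω \ ⋃ j : Fin k, Metric.ball (f^[(j : ℕ)] x₀) (r j), g x = f x) ∧
        -- (c) `d_Lip(f,g) < C` and `d_Lip(f⁻¹,g⁻¹) < C`
        f '' Ω = g '' Ω ∧
        (∀ x ∈ Ω, ‖f x - g x‖ ≤ C) ∧
        (∀ x ∈ Ω, ∀ y ∈ Ω, ‖(f x - g x) - (f y - g y)‖ ≤ C * dist x y) ∧
        ∃ F G : EuclideanSpace ℝ (Fin d) → EuclideanSpace ℝ (Fin d),
          Set.InvOn F f Ω (f '' Ω) ∧ Set.InvOn G g Ω (f '' Ω) ∧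
          (∀ y ∈ f '' Ω, ‖F y - G y‖ ≤ C) ∧
          (∀ y ∈ f '' Ω, ∀ z ∈ f '' Ω, ‖(F y - G y) - (F z - G z)‖ ≤ C * dist y z) := by
  let p : Fin k → EuclideanSpace ℝ (Fin d) := fun j ↦ f^[(j : ℕ)] x₀
  have hpΩ : ∀ j, p j ∈ Ω := fun j ↦ horb j j.2
  have hfp : ∀ j, f (p j) = f^[((j : ℕ) + 1) % k] x₀ := fun j ↦
    apply_iterate_eq_iterate_mod hper j
  choose c hc S hS hloc using fun j ↦
    exists_controlled_localizedDiffeo_of_det_pos hΩ hinj (hpΩ j) hf (hdet _ (hpΩ j))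
  obtain ⟨R, hR, hsmall⟩ := exists_forall_closedBall_disjoint
    (iterate_injective_of_minimal_period hper hmin) hΩ hpΩ hS
  have hcsum : 0 ≤ ∑ j, c j := Finset.sum_nonneg fun j _ ↦ hc j
  refine ⟨∑ j, c j + 1, by positivity, R, hR, fun r hr hrR ↦ ?_⟩
  obtain ⟨hdisj, hsub, hrS⟩ := hsmall r hr hrR
  choose ρ L Φ Φ' hρ hρr hΦ htrans hsup hlip hsup' hlip' using fun j ↦ hloc j r hr (hrS j)
  have hoff : ∀ j, ∀ x ∉ Metric.ball (p j) r, Φ j x = x := fun j ↦ (hΦ j).eq_self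
  have hoff' : ∀ j, ∀ x ∉ Metric.ball (p j) r, Φ' j x = x := fun j x ↦ (hΦ j).inv_eq_self
  have hball : ∀ j, ∀ x ∈ Metric.ball (p j) r, Φ j x ∈ Metric.ball (p j) r :=
    fun j x ↦ (hΦ j).mem_ball
  have hball' : ∀ j, ∀ x ∈ Metric.ball (p j) r, Φ' j x ∈ Metric.ball (p j) r :=
    fun j x ↦ (hΦ j).inv_mem_ball
  have hleft : Function.LeftInverse (glue Φ') (glue Φ) :=
    leftInverse_glue hdisj hoff hoff' hball fun j ↦ (hΦ j).left_inv
  have hright : Function.LeftInverse (glue Φ) (glue Φ') :=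
    leftInverse_glue hdisj hoff' hoff hball' fun j ↦ (hΦ j).right_inv
  have hmapsΩ : Set.MapsTo (glue Φ) Ω Ω := mapsTo_glue hdisj hoff hball hsub
  have hmapsΩ' : Set.MapsTo (glue Φ') Ω Ω := mapsTo_glue hdisj hoff' hball' hsub
  have hglue : ContDiff ℝ 2 (glue Φ) := contDiff_glue fun j ↦ (hΦ j).contDiff
  have hdiff : ∀ x, f x - f (glue Φ x) = ∑ j, (f x - f (Φ j x)) :=
    sub_comp_glue_eq_sum f hdisj hoff
  have hdiff' : ∀ x, x - glue Φ' x = ∑ j, (x - Φ' j x) := sub_comp_glue_eq_sum id hdisj hoff'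
  have : Nonempty (Fin k) := ⟨⟨0, hk⟩⟩
  obtain ⟨j₀, hj₀⟩ := Finite.exists_min ρ
  refine ⟨f ∘ glue Φ, fun _ ↦ r, fun _ ↦ ρ j₀, fun j ↦ ⟨hρ j₀, hρr j₀, le_rfl⟩, hdisj, hsub,
    hf.comp hglue.contDiffOn hmapsΩ, hinj.comp hleft.injective.injOn hmapsΩ, hmaps.comp hmapsΩ,
    fun x hx ↦ ?_, fun j ↦ ⟨fun x hx ↦ ?_, ?_⟩, fun x hx ↦ ?_, ?_, fun x hx ↦ ?_,
    fun x hx y hy ↦ ?_, Function.invFunOn f Ω, glue Φ' ∘ Function.invFunOn f Ω, ?_, ?_, ?_, ?_⟩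
  · have hfx : DifferentiableAt ℝ f (glue Φ x) :=
      (hf.contDiffAt (hΩ.mem_nhds (hmapsΩ hx))).differentiableAt (by norm_num)
    rw [fderiv_comp x hfx (hglue.differentiable (by norm_num) x)]
    have hfinj : Function.Injective (fderiv ℝ f (glue Φ x)) :=
      ((fderiv ℝ f (glue Φ x)).toContinuousLinearEquivOfDetNeZero
        (hdet _ (hmapsΩ hx)).ne').injective
    exact hfinj.comp (fderiv_glue_injective hdisj hoff (fun j ↦ (hΦ j).fderiv_injective) x)
  · have hxρ : x ∈ Metric.ball (p j) (ρ j) := Metric.ball_subset_ball (hj₀ j) hx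
    rw [Function.comp_apply,
      glue_eq_of_mem_ball hdisj hoff (Metric.ball_subset_ball (hρr j).le hxρ), htrans j x hxρ, hfp]
  · simp
  · rw [Function.comp_apply, glue_eq_self fun j ↦ hoff j x fun h ↦ hx.2 (Set.mem_iUnion.2 ⟨j, h⟩)]
  · rw [Set.image_comp, (Set.InvOn.bijOn ⟨hleft.leftInvOn Ω, hright.leftInvOn Ω⟩
      hmapsΩ hmapsΩ').image_eq]
  · rw [Function.comp_apply, hdiff]
    exact (norm_sum_le_of_le _ fun j _ ↦ hsup j x hx).trans (by linarith)
  · rw [Function.comp_apply, Function.comp_apply, hdiff, hdiff, ← Finset.sum_sub_distrib]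
    refine (norm_sum_le_of_le _ fun j _ ↦ hlip j x hx y hy).trans ?_
    rw [← Finset.sum_mul, dist_eq_norm]
    gcongr
    linarith
  · exact ⟨hinj.leftInvOn_invFunOn, (Set.surjOn_image f Ω).rightInvOn_invFunOn⟩
  · refine ⟨fun x hx ↦ ?_, ?_⟩
    · rw [Function.comp_apply, Function.comp_apply, hinj.leftInvOn_invFunOn (hmapsΩ hx), hleft x]
    · rintro _ ⟨x, hx, rfl⟩
      rw [Function.comp_apply, Function.comp_apply, hinj.leftInvOn_invFunOn hx, hright x]
  · rintro _ ⟨x, hx, rfl⟩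
    rw [Function.comp_apply, hinj.leftInvOn_invFunOn hx, hdiff']
    exact (norm_sum_le_of_le _ fun j _ ↦ (norm_sub_rev _ _).trans_le (hsup' j x hx)).trans
      (by linarith)
  · rintro _ ⟨x, hx, rfl⟩ _ ⟨y, hy, rfl⟩
    rw [Function.comp_apply, Function.comp_apply, hinj.leftInvOn_invFunOn hx,
      hinj.leftInvOn_invFunOn hy, hdiff', hdiff', ← Finset.sum_sub_distrib]
    refine (norm_sum_le_of_le _ fun j _ ↦ ?_).trans
      (b := ∑ j, c j * ‖f x - f y‖) ?_
    · rw [← norm_neg, show -(x - Φ' j x - (y - Φ' j y)) = Φ' j x - x - (Φ' j y - y) by abel]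
      exact hlip' j x hx y hy
    · rw [← Finset.sum_mul, dist_eq_norm]
      gcongr
      linarith
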